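/- arXiv:1308.1504 — 2 statements merged into one kernel-verified Lean document; each statement's English description precedes it below -/
import Mathlib

section
/- (Main deterministic stabilization theorem.) Let n ≥ 1, T > 0, S₁, …, S_m ∈ u(n), f₁, …, f_m > 0, and let X_goal ∈ U(n) with det(I + X_goal) ≠ 0. Let ū₁, …, ū_m : ℝ → ℝ be Coron reference controls for the system (smooth, T-periodic, with ū_k(T − t) = −ū_k(t), and span_ℝ{C_k^j(0) : k = 1,…,m, j ∈ ℕ} = u(n)). Let X̄_I : ℝ → U(n) be the solution of X̄_I'(t) = Σ_{k=1}^m ū_k(t) S_k X̄_I(t) with X̄_I(0) = I, and put X̄(t) = X̄_I(t) X_goal. Let X : [0, ∞) → U(n) be a solution of X'(t) = Σ_{k=1}^m (ū_k(t) + ũ_k(X̄(t)†X(t), t)) S_k X(t) with X(0) = I, where ũ_k(X̃, t) = f_k Tr(X̃(X̃ − I)(X̃ + I)^{−3} X̄(t)† S_k X̄(t)). Then lim_{t→∞} X̄(t)† X(t) = I; in particular lim_{j→∞} X(jT) = X_goal. -/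
open Matrix Filter

attribute [local instance] Matrix.frobeniusNormedAddCommGroup Matrix.frobeniusNormedSpace

/-- The iterated matrices `C_k^j(t)` of the return method:
`C_k^0(t) = S_k`, `C_k^{j+1}(t) = (d/dt) C_k^j(t) + [C_k^j(t), A(t)]`. -/
noncomputable def Cmat {n : ℕ} (A : ℝ → Matrix (Fin n) (Fin n) ℂ)
    (S0 : Matrix (Fin n) (Fin n) ℂ) : ℕ → ℝ → Matrix (Fin n) (Fin n) ℂ
  | 0, _ => S0
  | j + 1, t => deriv (fun s => Cmat A S0 j s) t
      + (Cmat A S0 j t * A t - A t * Cmat A S0 j t)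

/-- The feedback direction matrix `X̃ (X̃ - I) (X̃ + I)⁻³`. -/
noncomputable def fbMat {n : ℕ} (X : Matrix (Fin n) (Fin n) ℂ) : Matrix (Fin n) (Fin n) ℂ :=
  X * (X - 1) * ((X + 1)⁻¹ * (X + 1)⁻¹ * (X + 1)⁻¹)

/-- The feedback law `ũ_k(X̃, t) = f_k Tr (X̃(X̃-I)(X̃+I)⁻³ X̄(t)ᴴ S_k X̄(t))`
(the trace is real; we take its real part). -/
noncomputable def utildeFb {n : ℕ} (f : ℝ) (Sk : Matrix (Fin n) (Fin n) ℂ)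
    (Xbar : ℝ → Matrix (Fin n) (Fin n) ℂ) (Xt : Matrix (Fin n) (Fin n) ℂ) (t : ℝ) : ℝ :=
  f * ((fbMat Xt * ((Xbar t)ᴴ * Sk * Xbar t)).trace).re

section aux
open Topology
attribute [local instance] Matrix.frobeniusNormedRing Matrix.frobeniusNormedAlgebra

theorem aux_barbalat (v h : ℝ → ℝ) (L : ℝ)
    (hv : ∀ t ∈ Set.Ici (0:ℝ), HasDerivWithinAt v (-(h t)) (Set.Ici 0) t)
    (hu : UniformContinuousOn h (Set.Ici 0))
    (hL : Tendsto v atTop (𝓝 L)) : Tendsto h atTop (𝓝 0) := by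
  rw [Metric.tendsto_atTop]
  intro ε hε
  rw [Metric.uniformContinuousOn_iff] at hu
  obtain ⟨δ, hδ, hu⟩ := hu (ε/2) (by positivity)
  have h2 : Tendsto (fun t => (v (t + δ/2) - v t)/(δ/2)) atTop (𝓝 ((L - L)/(δ/2))) := by
    refine Tendsto.div_const (Tendsto.sub (hL.comp (tendsto_atTop_add_const_right _ _ tendsto_id)) hL) _
  rw [sub_self, zero_div, Metric.tendsto_atTop] at h2
  obtain ⟨N, hN⟩ := h2 (ε/2) (by positivity)
  refine ⟨max N 0, fun t ht => ?_⟩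
  have ht0 : 0 ≤ t := le_trans (le_max_right _ _) ht
  have htN : N ≤ t := le_trans (le_max_left _ _) ht
  obtain ⟨c, hc, hc2⟩ := exists_hasDerivAt_eq_slope v (fun t => -(h t)) (a := t) (b := t + δ/2)
    (by linarith) (fun s hs => ((hv s (le_trans ht0 hs.1)).continuousWithinAt).mono
      (fun r hr => le_trans ht0 hr.1))
    (fun s hs => (hv s (le_trans ht0 hs.1.le)).hasDerivAt (Ici_mem_nhds (lt_of_le_of_lt ht0 hs.1)))
  have h3 := hN t htN
  rw [show t + δ/2 - t = δ/2 by ring] at hc2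
  rw [← hc2] at h3
  have h4 := hu t ht0 c (le_trans ht0 hc.1.le) (by
    rw [Real.dist_eq, abs_lt]; constructor <;> linarith [hc.1, hc.2])
  rw [Real.dist_eq, abs_lt] at *
  constructor <;> linarith [h3.1, h3.2, h4.1, h4.2]

theorem aux_diff {E : Type*} [NormedAddCommGroup E] [NormedSpace ℝ E] (Y D : ℝ → E)
    (hY : ∀ t ∈ Set.Ici (0:ℝ), HasDerivWithinAt Y (D t) (Set.Ici 0) t)
    (hD : Tendsto D atTop (𝓝 0)) (t : ℝ) :
    Tendsto (fun s => Y (s + t) - Y s) atTop (𝓝 0) := by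
  rw [Metric.tendsto_atTop]
  intro ε hε
  rw [Metric.tendsto_atTop] at hD
  obtain ⟨N, hN⟩ := hD (ε/(|t|+1)) (by positivity)
  refine ⟨max N 0 + |t|, fun s hs => ?_⟩
  have h1 := (convex_Ici (max N 0)).norm_image_sub_le_of_norm_hasDerivWithin_le
    (f := Y) (f' := D) (C := ε/(|t|+1)) (x := s) (y := s + t)
    (fun r hr => (hY r (le_trans (le_max_right _ _) hr)).mono
      (Set.Ici_subset_Ici.2 (le_max_right _ _)))
    (fun r hr => by simpa using (hN r (le_trans (le_max_left _ _) hr)).le)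
    (Set.mem_Ici.2 (by linarith [abs_nonneg t]))
    (Set.mem_Ici.2 (by linarith [neg_abs_le t]))
  rw [dist_zero_right]
  refine lt_of_le_of_lt h1 ?_
  simp only [add_sub_cancel_left, Real.norm_eq_abs]
  rw [div_mul_eq_mul_div, div_lt_iff₀ (by positivity)]
  nlinarith [abs_nonneg t]

theorem aux_periodic_uc {F : Type*} [NormedAddCommGroup F] (T : ℝ) (hT : 0 < T)
    (B : ℝ → F) (hB : Continuous B) (hBp : Function.Periodic B T) : UniformContinuous B := by
  have : Fact (0 < T) := ⟨hT⟩
  have h1 : Continuous (hBp.lift : AddCircle T → F) := continuous_coinduced_dom.2 hB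
  have h2 := CompactSpace.uniformContinuous_of_continuous h1
  have h3 : UniformContinuous (fun x : ℝ => (x : AddCircle T)) :=
    uniformContinuous_addMonoidHom_of_continuous
      (f := QuotientAddGroup.mk' (AddSubgroup.zmultiples T)) continuous_coinduced_rng
  exact h2.comp h3

theorem aux_prodMk {E F : Type*} [NormedAddCommGroup E] [NormedAddCommGroup F] {Y : ℝ → E}
    {B : ℝ → F} {s : Set ℝ} (hY : UniformContinuousOn Y s) (hB : UniformContinuousOn B s) :
    UniformContinuousOn (fun t => (Y t, B t)) s := by
  rw [uniformContinuousOn_iff_restrict] at *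
  exact hY.prodMk hB

theorem aux_lasalle {E F : Type*} [NormedAddCommGroup E] [NormedSpace ℝ E] [ProperSpace E]
    [NormedAddCommGroup F] (T : ℝ) (hT : 0 < T)
    (B : ℝ → F) (hB : Continuous B) (hBp : Function.Periodic B T)
    (Y : ℝ → E) (K : ℝ) (hYK : ∀ t ∈ Set.Ici (0:ℝ), ‖Y t‖ ≤ K)
    (Ψ : E × F → E) (hΨ : Continuous Ψ) (Φ : E × F → ℝ) (hΦ : Continuous Φ)
    (hΦ0 : ∀ p, 0 ≤ Φ p) (hΦΨ : ∀ p, Φ p = 0 → Ψ p = 0)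
    (G : Set E) (hG : IsClosed G) (hYG : ∀ t ∈ Set.Ici (0:ℝ), Y t ∈ G)
    (V : E → ℝ) (hV : Continuous V)
    (hY : ∀ t ∈ Set.Ici (0:ℝ), HasDerivWithinAt Y (Ψ (Y t, B t)) (Set.Ici 0) t)
    (hVY : ∀ t ∈ Set.Ici (0:ℝ),
      HasDerivWithinAt (fun t => V (Y t)) (-(Φ (Y t, B t))) (Set.Ici 0) t) :
    ∃ y ∈ G, (∀ t, Φ (y, B t) = 0) ∧ Tendsto (fun t => V (Y t)) atTop (𝓝 (V y)) := by
  have hcE : IsCompact (Metric.closedBall (0:E) K) := isCompact_closedBall _ _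
  have hcF : IsCompact (Set.range B) := hBp.compact_of_continuous hT.ne' hB
  have hcK := hcE.prod hcF
  have hmem : ∀ t ∈ Set.Ici (0:ℝ), (Y t, B t) ∈ Metric.closedBall (0:E) K ×ˢ Set.range B := by
    intro t ht
    exact ⟨by simpa using hYK t ht, t, rfl⟩
  have hev : ∀ᶠ t in atTop, (Y t, B t) ∈ Metric.closedBall (0:E) K ×ˢ Set.range B := by
    filter_upwards [eventually_ge_atTop 0] with t ht using hmem t ht
  -- convergence of V
  obtain ⟨c, hc⟩ := hcE.bddBelow_image hV.continuousOn
  have hcV : ∀ t ∈ Set.Ici (0:ℝ), c ≤ V (Y t) := fun t ht => hc ⟨Y t, (hmem t ht).1, rfl⟩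
  have hanti : AntitoneOn (fun t => V (Y t)) (Set.Ici 0) := by
    refine antitoneOn_of_hasDerivWithinAt_nonpos (f' := fun t => -(Φ (Y t, B t))) (convex_Ici 0)
      (fun t ht => (hVY t ht).continuousWithinAt) ?_ ?_
    · intro t ht
      exact (hVY t (interior_subset ht)).mono interior_subset
    · intro t ht
      have := hΦ0 (Y t, B t)
      linarith
  obtain ⟨L, hL⟩ : ∃ L, Tendsto (fun t => V (Y t)) atTop (𝓝 L) := by
    have h1 : Antitone (fun t => V (Y (max t 0))) := fun s t hst =>
      hanti (Set.mem_Ici.2 (le_max_right _ _)) (Set.mem_Ici.2 (le_max_right _ _)) (max_le_max_right _ hst)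
    have h2 : BddBelow (Set.range (fun t => V (Y (max t 0)))) :=
      ⟨c, by rintro _ ⟨t, rfl⟩; exact hcV _ (Set.mem_Ici.2 (le_max_right _ _))⟩
    refine ⟨_, (tendsto_atTop_ciInf h1 h2).congr' ?_⟩
    filter_upwards [eventually_ge_atTop 0] with t ht
    rw [max_eq_left ht]
  -- uniform continuity
  obtain ⟨C, hC⟩ := hcK.exists_bound_of_continuousOn hΨ.continuousOn
  have hYlip : UniformContinuousOn Y (Set.Ici 0) := by
    have : LipschitzOnWith (Real.toNNReal C) Y (Set.Ici 0) := by
      refine (convex_Ici 0).lipschitzOnWith_of_nnnorm_hasDerivWithin_le hY ?_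
      intro t ht
      rw [← NNReal.coe_le_coe, coe_nnnorm]
      exact (hC _ (hmem t ht)).trans (Real.le_coe_toNNReal _)
    exact this.uniformContinuousOn
  have hBu : UniformContinuous B := aux_periodic_uc T hT B hB hBp
  have hu : UniformContinuousOn (fun t => Φ (Y t, B t)) (Set.Ici 0) :=
    (hcK.uniformContinuousOn_of_continuous hΦ.continuousOn).comp
      (aux_prodMk hYlip hBu.uniformContinuousOn) hmem
  have hΦlim := aux_barbalat _ _ L hVY hu hL
  have hΨlim : Tendsto (fun t => Ψ (Y t, B t)) atTop (𝓝 0) := by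
    rw [tendsto_iff_ultrafilter]
    intro u hu
    obtain ⟨p, hp, hup⟩ := hcK.ultrafilter_le_nhds (u.map (fun t => (Y t, B t)))
      (by rw [le_principal_iff]; exact hu hev)
    have hup : Tendsto (fun t => (Y t, B t)) u (𝓝 p) := hup
    have h1 := (hΦ.tendsto p).comp hup
    have h2 := tendsto_nhds_unique h1 (hΦlim.mono_left hu)
    rw [← hΦΨ p h2]
    exact (hΨ.tendsto p).comp hup
  have hjT : Tendsto (fun j : ℕ => (j:ℝ) * T) atTop atTop :=
    tendsto_natCast_atTop_atTop.atTop_mul_const hT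
  let u : Ultrafilter ℕ := Ultrafilter.of atTop
  have hule : (u : Filter ℕ) ≤ atTop := Ultrafilter.of_le atTop
  obtain ⟨y, hy, huy⟩ := hcE.ultrafilter_le_nhds (u.map (fun j : ℕ => Y (j * T)))
      (by
        rw [le_principal_iff]
        have h0 : ∀ᶠ j : ℕ in atTop, Y (j * T) ∈ Metric.closedBall (0:E) K :=
          (hjT.eventually hev).mono fun j hj => hj.1
        exact hule h0)
  have huy : Tendsto (fun j : ℕ => Y (j * T)) u (𝓝 y) := huy
  have hyG : y ∈ G := hG.mem_of_tendsto huy (hule (by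
    have h0 : ∀ᶠ j : ℕ in atTop, Y (j * T) ∈ G :=
      hjT.eventually ((eventually_ge_atTop 0).mono hYG)
    exact h0))
  refine ⟨y, hyG, fun t => ?_, ?_⟩
  · have h1 := ((aux_diff Y _ hY hΨlim t).comp hjT).mono_left hule
    have h2 := h1.add huy
    rw [zero_add] at h2
    have h3 : Tendsto (fun j : ℕ => Φ (Y (j*T + t), B (j * T + t))) u (𝓝 0) :=
      (hΦlim.comp (tendsto_atTop_add_const_right _ t hjT)).mono_left hule
    have h4 : Tendsto (fun j : ℕ => (Y (j*T + t), B (j * T + t))) u (𝓝 (y, B t)) := by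
      refine Tendsto.prodMk_nhds (h2.congr fun j => by simp) ?_
      refine tendsto_const_nhds.congr fun j => ?_
      rw [add_comm, hBp.nat_mul j t]
    exact tendsto_nhds_unique ((hΦ.tendsto _).comp h4) h3
  · have h1 := (hL.comp hjT).mono_left hule
    have h2 := (hV.tendsto y).comp huy
    rw [tendsto_nhds_unique h2 h1]
    exact hL

theorem hmul1 {n : ℕ} {P Q : ℝ → Matrix (Fin n) (Fin n) ℂ} {P' Q' : Matrix (Fin n) (Fin n) ℂ} {s t}
  (hP : HasDerivWithinAt P P' s t) (hQ : HasDerivWithinAt Q Q' s t) :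
  HasDerivWithinAt (fun t => P t * Q t) (P' * Q t + P t * Q') s t := hP.mul hQ
theorem hct {n : ℕ} {P : ℝ → Matrix (Fin n) (Fin n) ℂ} {P' : Matrix (Fin n) (Fin n) ℂ} {s t}
  (hP : HasDerivWithinAt P P' s t)  :
  HasDerivWithinAt (fun t => (P t)ᴴ) (P'ᴴ) s t := by
  let L : Matrix (Fin n) (Fin n) ℂ →ₗ[ℝ] Matrix (Fin n) (Fin n) ℂ :=
    { toFun := fun A => Aᴴ
      map_add' := by intros; simp
      map_smul' := by intros; simp }
  exact (LinearMap.toContinuousLinearMap L).hasFDerivAt.comp_hasDerivWithinAt t hP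
theorem htr {n : ℕ} {P : ℝ → Matrix (Fin n) (Fin n) ℂ} {P' : Matrix (Fin n) (Fin n) ℂ} {s t}
  (hP : HasDerivWithinAt P P' s t)  :
  HasDerivWithinAt (fun t => (P t).trace.re) (P'.trace.re) s t := by
  let L : Matrix (Fin n) (Fin n) ℂ →ₗ[ℝ] ℝ :=
    { toFun := fun A => A.trace.re
      map_add' := by intros; simp
      map_smul' := by intros; simp }
  exact (LinearMap.toContinuousLinearMap L).hasFDerivAt.comp_hasDerivWithinAt t hP
theorem hinv {n : ℕ} {P : ℝ → Matrix (Fin n) (Fin n) ℂ} {P' : Matrix (Fin n) (Fin n) ℂ} {s t}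
  (hP : HasDerivWithinAt P P' s t) (hd : (P t).det ≠ 0)  :
  HasDerivWithinAt (fun t => (P t)⁻¹) (-((P t)⁻¹ * P' * (P t)⁻¹)) s t := by
  have : CompleteSpace (Matrix (Fin n) (Fin n) ℂ) := FiniteDimensional.complete ℝ _
  have hu : IsUnit (P t) := (Matrix.isUnit_iff_isUnit_det _).2 hd.isUnit
  obtain ⟨x, hx⟩ := hu
  have h1 := hasFDerivAt_ringInverse (𝕜 := ℝ) x
  rw [hx] at h1
  have h2 := h1.comp_hasDerivWithinAt t hP
  have h3 : (↑x⁻¹ : Matrix (Fin n) (Fin n) ℂ) = (P t)⁻¹ := by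
    rw [← hx, Matrix.coe_units_inv]
  have h4 : HasDerivWithinAt (Ring.inverse ∘ P) (-((P t)⁻¹ * P' * (P t)⁻¹)) s t := by
    rw [h3] at h2
    exact h2
  refine h4.congr_of_eventuallyEq (Filter.Eventually.of_forall fun r => ?_) ?_ <;>
    exact Matrix.nonsing_inv_eq_ringInverse _
theorem aux_c (z : ℂ) : (star z * z).re = ‖z‖ ^ (2:ℝ) := by
  rw [Real.rpow_two, ← Complex.normSq_eq_norm_sq, Complex.normSq_apply]
  simp
theorem hnsq {n : ℕ} (A : Matrix (Fin n) (Fin n) ℂ) : (Aᴴ * A).trace.re = ‖A‖^2 := by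
  rw [Matrix.frobenius_norm_def, ← Real.sqrt_eq_rpow, Real.sq_sqrt (by positivity)]
  simp only [Matrix.trace, Matrix.diag, Matrix.mul_apply, Matrix.conjTranspose_apply, Complex.re_sum]
  rw [Finset.sum_comm]
  refine Finset.sum_congr rfl fun i _ => Finset.sum_congr rfl fun j _ => ?_
  exact aux_c (A i j)
theorem hconst {n : ℕ} {P Q A : ℝ → Matrix (Fin n) (Fin n) ℂ} {s : Set ℝ} (hs : Convex ℝ s)
    (hA : ∀ t ∈ s, (A t)ᴴ = -(A t))
    (hP : ∀ t ∈ s, HasDerivWithinAt P (A t * P t) s t)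
    (hQ : ∀ t ∈ s, HasDerivWithinAt Q (A t * Q t) s t) {a b : ℝ} (ha : a ∈ s) (hb : b ∈ s) :
    (P b)ᴴ * Q b = (P a)ᴴ * Q a := by
  have h := hs.norm_image_sub_le_of_norm_hasDerivWithin_le
    (f := fun t => (P t)ᴴ * Q t) (f' := fun _ => 0) (C := 0) (x := a) (y := b)
    (fun t ht => by
      have := hmul1 (hct (hP t ht)) (hQ t ht)
      rw [conjTranspose_mul, hA t ht] at this
      have h0 : (P t)ᴴ * -A t * Q t + (P t)ᴴ * (A t * Q t) = 0 := by noncomm_ring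
      rw [h0] at this
      exact this) (by simp) ha hb
  simpa [sub_eq_zero] using h
theorem aux_alg1 {n : ℕ} {Z : Matrix (Fin n) (Fin n) ℂ} (hd : (Z + 1).det ≠ 0) :
    Z * (Z + 1)⁻¹ = 1 - (Z + 1)⁻¹ ∧ (Z + 1)⁻¹ * Z = 1 - (Z + 1)⁻¹ := by
  have h1 := Matrix.mul_nonsing_inv (Z + 1) hd.isUnit
  have h2 := Matrix.nonsing_inv_mul (Z + 1) hd.isUnit
  constructor
  · rw [add_mul, one_mul] at h1
    exact eq_sub_of_add_eq h1
  · rw [mul_add, mul_one] at h2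
    exact eq_sub_of_add_eq h2

/-- Cayley transform -/
noncomputable def cay {n : ℕ} (Z : Matrix (Fin n) (Fin n) ℂ) : Matrix (Fin n) (Fin n) ℂ :=
  1 - ((Z + 1)⁻¹ + (Z + 1)⁻¹)

theorem cay_skew {n : ℕ} {Z : Matrix (Fin n) (Fin n) ℂ} (hZ : Zᴴ * Z = 1)
    (hd : (Z + 1).det ≠ 0) : (cay Z)ᴴ = -(cay Z) := by
  unfold cay
  have h1 := Matrix.mul_nonsing_inv (Z + 1) hd.isUnit
  set R := (Z + 1)⁻¹ with hR
  have h2 : Rᴴ * (Zᴴ + 1) = 1 := by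
    have := congrArg conjTranspose h1
    simpa [conjTranspose_mul] using this
  have h3 : R = Rᴴ * (Zᴴ + 1) * R := by rw [h2, one_mul]
  have h4 : Rᴴ = Rᴴ * ((Z + 1) * R) := by rw [h1, mul_one]
  have h5 : (1 : Matrix (Fin n) (Fin n) ℂ) = Rᴴ * (Zᴴ + 1) * ((Z + 1) * R) := by
    rw [h1, h2, one_mul]
  have h6 : Rᴴ * (Zᴴ + 1) * ((Z + 1) * R) = Rᴴ * (Zᴴ * Z + (Zᴴ + 1) + Z) * R := by noncomm_ring
  have h7 : R + Rᴴ = 1 := by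
    calc R + Rᴴ = Rᴴ * (Zᴴ + 1) * R + Rᴴ * ((Z + 1) * R) := by rw [← h3, ← h4]
      _ = Rᴴ * (1 + (Zᴴ + 1) + Z) * R := by noncomm_ring
      _ = 1 := by rw [hZ] at h6; exact h6.symm.trans h5.symm
  have h8 : Rᴴ = 1 - R := eq_sub_of_add_eq' h7
  simp only [conjTranspose_sub, conjTranspose_add, conjTranspose_one, h8]
  abel

theorem aux_ring1 {n : ℕ} {Z R : Matrix (Fin n) (Fin n) ℂ} (h1 : Z * R = 1 - R) : Z * (Z - 1) * (R * R * R) = (1 - R) * (1 - (R + R)) * R := by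
  have e1 : (Z - 1) * R = 1 - (R + R) := by rw [sub_mul, h1, one_mul]; abel
  calc Z * (Z - 1) * (R * R * R) = Z * ((Z - 1) * R) * (R * R) := by noncomm_ring
    _ = (Z * R) * (1 - (R + R)) * R := by rw [e1]; noncomm_ring
    _ = _ := by rw [h1]

theorem aux_fb {n : ℕ} {Z : Matrix (Fin n) (Fin n) ℂ} (hd : (Z + 1).det ≠ 0) :
    fbMat Z = (1/4 : ℝ) • ((1 + cay Z) * cay Z * (1 - cay Z)) := by
  obtain ⟨h1, _⟩ := aux_alg1 hd
  unfold fbMat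
  rw [aux_ring1 h1]
  have e1 : 1 + cay Z = (2:ℝ) • (1 - (Z + 1)⁻¹) := by unfold cay; module
  have e2 : 1 - cay Z = (2:ℝ) • ((Z + 1)⁻¹) := by unfold cay; module
  rw [e1, e2]
  simp only [smul_mul_assoc, mul_smul_comm, smul_smul]
  norm_num
  rfl

theorem cay_deriv {n m : ℕ} {Z : ℝ → Matrix (Fin n) (Fin n) ℂ} {c : Fin m → ℝ}
    {b : Fin m → Matrix (Fin n) (Fin n) ℂ} {s : Set ℝ} {t : ℝ}
    (hZ : HasDerivWithinAt Z (∑ k, c k • (b k * Z t)) s t) (hd : (Z t + 1).det ≠ 0) :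
    HasDerivWithinAt (fun t => cay (Z t))
      (∑ k, (1/2 * c k) • ((1 - cay (Z t)) * b k * (1 + cay (Z t)))) s t := by
  have h0 : HasDerivWithinAt (fun t => Z t + 1) (∑ k, c k • (b k * Z t)) s t := hZ.add_const _
  have h1 := hinv h0 hd
  have h2 : HasDerivWithinAt (fun t => 1 - ((Z t + 1)⁻¹ + (Z t + 1)⁻¹)) _ s t :=
    (h1.add h1).const_sub 1
  obtain ⟨e1, _⟩ := aux_alg1 hd
  refine HasDerivWithinAt.congr_deriv h2 ?_
  symm
  have e3 : 1 + cay (Z t) = (2:ℝ) • (Z t * (Z t + 1)⁻¹) := by rw [e1]; unfold cay; module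
  have e4 : 1 - cay (Z t) = (2:ℝ) • ((Z t + 1)⁻¹) := by unfold cay; module
  rw [e3, e4, Finset.mul_sum, Finset.sum_mul, neg_add, neg_neg, ← Finset.sum_add_distrib]
  refine Finset.sum_congr rfl fun k _ => ?_
  simp only [smul_mul_assoc, mul_smul_comm, smul_smul, ← add_smul, mul_assoc]
  congr 1
  ring

theorem trace_cont {n : ℕ} : Continuous (fun A : Matrix (Fin n) (Fin n) ℂ => A.trace.re) := by
  fun_prop

theorem norm_sq_skew {n : ℕ} {y : Matrix (Fin n) (Fin n) ℂ} (hy : yᴴ = -y) :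
    -(y * y).trace.re = ‖y‖^2 := by
  rw [← hnsq, hy, neg_mul, trace_neg, Complex.neg_re]

theorem aux_y0 {n : ℕ} {y : Matrix (Fin n) (Fin n) ℂ} (hy : yᴴ = -y)
    (h : ((1 + y) * y * (1 - y) * y).trace.re = 0) : y = 0 := by
  have h1 : (1 + y) * y * (1 - y) * y = y * y - (y * y) * (y * y) := by noncomm_ring
  have h2 : (y * y)ᴴ = y * y := by rw [conjTranspose_mul, hy]; noncomm_ring
  have h3 := hnsq (y * y)
  have h4 := norm_sq_skew hy
  rw [h2] at h3
  rw [h1, trace_sub, Complex.sub_re] at h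
  have h5 : ‖y‖^2 = 0 := by nlinarith [sq_nonneg ‖y‖, sq_nonneg ‖y*y‖]
  exact norm_eq_zero.1 (pow_eq_zero_iff (two_ne_zero) |>.1 h5)

/-- the dissipation weight -/
noncomputable def wfun {n : ℕ} (y c : Matrix (Fin n) (Fin n) ℂ) : ℝ :=
  ((1 + y) * y * (1 - y) * c).trace.re

theorem V_deriv {n m : ℕ} {Y : ℝ → Matrix (Fin n) (Fin n) ℂ} {f : Fin m → ℝ}
    {b : Fin m → Matrix (Fin n) (Fin n) ℂ} {s : Set ℝ} {t : ℝ}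
    (hY : HasDerivWithinAt Y (∑ k, (1/2 * (f k / 4 * wfun (Y t) (b k))) •
      ((1 - Y t) * b k * (1 + Y t))) s t) :
    HasDerivWithinAt (fun t => -(Y t * Y t).trace.re)
      (-(∑ k, f k / 4 * wfun (Y t) (b k) ^ 2)) s t := by
  have h1 := (htr (hmul1 hY hY)).neg
  refine HasDerivWithinAt.congr_deriv h1 ?_
  symm
  congr 1
  rw [trace_add, trace_mul_comm, ← trace_add, Finset.mul_sum, ← Finset.sum_add_distrib,
    trace_sum, Complex.re_sum]
  refine Finset.sum_congr rfl fun k _ => ?_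
  have h2 : (Y t * ((1 - Y t) * b k * (1 + Y t))).trace.re = wfun (Y t) (b k) := by
    unfold wfun
    rw [trace_mul_comm, mul_assoc, trace_mul_comm]
    have h3 : (1 + Y t) * Y t * ((1 - Y t) * b k) = (1 + Y t) * Y t * (1 - Y t) * b k := by
      noncomm_ring
    rw [← h3, trace_mul_comm]
  rw [mul_smul_comm, ← add_smul, trace_smul, Complex.smul_re, h2, smul_eq_mul]
  ring

theorem core {n m : ℕ} (T : ℝ) (hT : 0 < T) (f : Fin m → ℝ) (hf : ∀ k, 0 < f k)
    (B : ℝ → Fin m → Matrix (Fin n) (Fin n) ℂ) (hB : Continuous B) (hBp : Function.Periodic B T)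
    (Z : ℝ → Matrix (Fin n) (Fin n) ℂ) (hZu : ∀ t ∈ Set.Ici (0:ℝ), (Z t)ᴴ * Z t = 1)
    (hZ0 : (Z 0 + 1).det ≠ 0)
    (hZ : ∀ t ∈ Set.Ici (0:ℝ), HasDerivWithinAt Z
      (∑ k, (f k * (fbMat (Z t) * B t k).trace.re) • (B t k * Z t)) (Set.Ici 0) t)
    (hC : ∀ y : Matrix (Fin n) (Fin n) ℂ, yᴴ = -y → (∀ t k, wfun y (B t k) = 0) →
      wfun y y = 0) :
    Tendsto Z atTop (𝓝 1) := by
  let Ψ : Matrix (Fin n) (Fin n) ℂ × (Fin m → Matrix (Fin n) (Fin n) ℂ) →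
      Matrix (Fin n) (Fin n) ℂ := fun p =>
    ∑ k, (1/2 * (f k / 4 * wfun p.1 (p.2 k))) • ((1 - p.1) * p.2 k * (1 + p.1))
  let Φ : Matrix (Fin n) (Fin n) ℂ × (Fin m → Matrix (Fin n) (Fin n) ℂ) → ℝ := fun p =>
    ∑ k, f k / 4 * wfun p.1 (p.2 k) ^ 2
  have hwc : ∀ k : Fin m, Continuous (fun p : Matrix (Fin n) (Fin n) ℂ ×
      (Fin m → Matrix (Fin n) (Fin n) ℂ) => wfun p.1 (p.2 k)) := by
    intro k
    unfold wfun
    refine trace_cont.comp ?_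
    fun_prop
  have hΨ : Continuous Ψ := by
    refine continuous_finsetSum _ fun k _ => ?_
    refine Continuous.smul (continuous_const.mul (continuous_const.mul (hwc k))) ?_
    fun_prop
  have hΦ : Continuous Φ := by
    refine continuous_finsetSum _ fun k _ => ?_
    exact continuous_const.mul ((hwc k).pow 2)
  have hΦ0 : ∀ p, 0 ≤ Φ p := fun p => Finset.sum_nonneg fun k _ => by
    have := hf k
    positivity
  have hΦw : ∀ p, Φ p = 0 → ∀ k, wfun p.1 (p.2 k) = 0 := by
    intro p hp k
    have h1 := (Finset.sum_eq_zero_iff_of_nonneg (fun k _ => by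
      have := hf k
      positivity)).1 hp k (Finset.mem_univ k)
    have := hf k
    rcases mul_eq_zero.1 h1 with h | h
    · linarith
    · exact pow_eq_zero_iff (two_ne_zero) |>.1 h
  have hΦΨ : ∀ p, Φ p = 0 → Ψ p = 0 := by
    intro p hp
    refine Finset.sum_eq_zero fun k _ => ?_
    rw [hΦw p hp k]
    simp
  have hYd : ∀ s ⊆ Set.Ici (0:ℝ), ∀ t ∈ s, (Z t + 1).det ≠ 0 →
      HasDerivWithinAt (fun t => cay (Z t)) (Ψ (cay (Z t), B t)) s t := by
    intro s hs t ht hd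
    have h1 := cay_deriv ((hZ t (hs ht)).mono hs) hd
    refine HasDerivWithinAt.congr_deriv h1 ?_
    refine Finset.sum_congr rfl fun k _ => ?_
    rw [aux_fb hd, smul_mul_assoc, trace_smul, Complex.smul_re, smul_eq_mul]
    congr 2
    unfold wfun
    ring
  have hVd : ∀ s ⊆ Set.Ici (0:ℝ), ∀ t ∈ s, (Z t + 1).det ≠ 0 →
      HasDerivWithinAt (fun t => -(cay (Z t) * cay (Z t)).trace.re) (-(Φ (cay (Z t), B t))) s t :=
    fun s hs t ht hd => V_deriv (hYd s hs t ht hd)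
  have hbd : ∀ b : ℝ, (∀ t ∈ Set.Ico 0 b, (Z t + 1).det ≠ 0) → ∀ t ∈ Set.Ico 0 b,
      ‖cay (Z t)‖ ≤ ‖cay (Z 0)‖ := by
    intro b hb t ht
    have hsub : Set.Ico 0 b ⊆ Set.Ici (0:ℝ) := fun r hr => hr.1
    have hanti : AntitoneOn (fun t => -(cay (Z t) * cay (Z t)).trace.re) (Set.Ico 0 b) := by
      refine antitoneOn_of_hasDerivWithinAt_nonpos (f' := fun t => -(Φ (cay (Z t), B t)))
        (convex_Ico 0 b)
        (fun t ht => (hVd _ hsub t ht (hb t ht)).continuousWithinAt) ?_ ?_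
      · intro t ht
        have ht' := interior_subset ht
        exact (hVd _ hsub t ht' (hb t ht')).mono interior_subset
      · intro t ht
        have := hΦ0 (cay (Z t), B t)
        linarith
    have h0 : (0:ℝ) ∈ Set.Ico 0 b := ⟨le_rfl, lt_of_le_of_lt ht.1 ht.2⟩
    have h1 := hanti h0 ht ht.1
    simp only [] at h1
    rw [norm_sq_skew (cay_skew (hZu t ht.1) (hb t ht)),
      norm_sq_skew (cay_skew (hZu 0 (Set.mem_Ici.2 le_rfl)) hZ0)] at h1
    exact (sq_le_sq₀ (norm_nonneg _) (norm_nonneg _)).1 h1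
  have hZc : ContinuousOn Z (Set.Ici 0) := fun t ht => (hZ t ht).continuousWithinAt
  have hdc : ContinuousOn (fun t => (Z t + 1).det) (Set.Ici 0) :=
    (Continuous.matrix_det continuous_id).comp_continuousOn (hZc.add continuousOn_const)
  have hdet : ∀ t ∈ Set.Ici (0:ℝ), (Z t + 1).det ≠ 0 := by
    by_contra! hcon
    obtain ⟨t1, ht1, hdt1⟩ := hcon
    let D : Set ℝ := Set.Ici 0 ∩ (fun t => (Z t + 1).det) ⁻¹' {0}
    have hDc : IsClosed D := hdc.preimage_isClosed_of_isClosed isClosed_Ici isClosed_singleton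
    have hDb : BddBelow D := ⟨0, fun r hr => hr.1⟩
    have hmem := hDc.csInf_mem ⟨t1, ht1, hdt1⟩ hDb
    set b := sInf D with hb
    have hb0 : 0 < b := by
      rcases eq_or_lt_of_le (show (0:ℝ) ≤ b from hmem.1) with h | h
      · exact absurd (by rw [h]; exact hmem.2) hZ0
      · exact h
    have hne : ∀ t ∈ Set.Ico 0 b, (Z t + 1).det ≠ 0 := by
      intro t ht h0
      exact absurd (csInf_le hDb (show t ∈ D from ⟨ht.1, h0⟩)) (not_le.2 ht.2)
    have hb1 := hbd b hne
    obtain ⟨C, hC⟩ := (isCompact_closedBall (0 : Matrix (Fin n) (Fin n) ℂ)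
      (‖cay (Z 0)‖)).exists_bound_of_continuousOn
      (f := fun y => ((1/2 : ℝ) • (1 - y)).det) (Continuous.continuousOn (by fun_prop))
    have hone : ∀ t ∈ Set.Ico 0 b, 1 ≤ ‖(Z t + 1).det‖ * C := by
      intro t ht
      have h1 := hC (cay (Z t)) (by simpa using hb1 t ht)
      have h2 : (1/2 : ℝ) • (1 - cay (Z t)) = (Z t + 1)⁻¹ := by unfold cay; module
      simp only [h2] at h1
      have h3 := congrArg Matrix.det (Matrix.mul_nonsing_inv (Z t + 1) (hne t ht).isUnit)
      rw [det_mul, det_one] at h3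
      calc (1:ℝ) = ‖(Z t + 1).det * ((Z t + 1)⁻¹).det‖ := by rw [h3]; simp
        _ = ‖(Z t + 1).det‖ * ‖((Z t + 1)⁻¹).det‖ := norm_mul _ _
        _ ≤ _ := by gcongr
    have hlim : Tendsto (fun t => ‖(Z t + 1).det‖ * C) (𝓝[Set.Ico 0 b] b)
        (𝓝 (‖(Z b + 1).det‖ * C)) :=
      (((hdc b hmem.1).mono (fun r hr => hr.1)).norm).mul_const C
    have hnb : (𝓝[Set.Ico 0 b] b).NeBot := by
      rw [← mem_closure_iff_nhdsWithin_neBot, closure_Ico hb0.ne]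
      exact ⟨hb0.le, le_rfl⟩
    have h1 := ge_of_tendsto hlim (eventually_nhdsWithin_of_forall hone)
    have h2 : (Z b + 1).det = 0 := hmem.2
    rw [h2] at h1
    simp at h1
    linarith
  have hfin : ∀ t ∈ Set.Ici (0:ℝ), ‖cay (Z t)‖ ≤ ‖cay (Z 0)‖ := fun t ht =>
    hbd (t+1) (fun r hr => hdet r hr.1) t ⟨ht, by linarith⟩
  obtain ⟨y, hy, hy1, hy2⟩ := aux_lasalle T hT B hB hBp (fun t => cay (Z t)) _ hfin Ψ hΨ Φ hΦ hΦ0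
    hΦΨ {y | yᴴ = -y} (isClosed_eq (by fun_prop) (by fun_prop))
    (fun t ht => cay_skew (hZu t ht) (hdet t ht))
    (fun y => -(y * y).trace.re) ((trace_cont.comp (by fun_prop)).neg)
    (fun t ht => hYd _ subset_rfl t ht (hdet t ht))
    (fun t ht => hVd _ subset_rfl t ht (hdet t ht))
  have hy0 : y = 0 := aux_y0 hy (hC y hy fun t k => hΦw _ (hy1 t) k)
  rw [hy0] at hy2
  have hn2 : Tendsto (fun t => ‖cay (Z t)‖) atTop (𝓝 0) := by
    have h1 : Tendsto (fun t => ‖cay (Z t)‖^2) atTop (𝓝 0) := by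
      refine Tendsto.congr' ?_ (by simpa using hy2)
      filter_upwards [eventually_ge_atTop 0] with t ht
      have := norm_sq_skew (cay_skew (hZu t ht) (hdet t ht))
      linarith
    have h2 := h1.sqrt
    simpa using h2
  have hnZ : ∀ t ∈ Set.Ici (0:ℝ), ‖Z t‖ = ‖(1 : Matrix (Fin n) (Fin n) ℂ)‖ := by
    intro t ht
    have h1 := hnsq (Z t)
    have h2 := hnsq (1 : Matrix (Fin n) (Fin n) ℂ)
    rw [hZu t ht] at h1
    rw [conjTranspose_one, one_mul, h1] at h2
    exact (pow_left_inj₀ (norm_nonneg _) (norm_nonneg _) two_ne_zero).1 h2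
  refine tendsto_iff_norm_sub_tendsto_zero.2 ?_
  have h3 := hn2.mul_const (‖(1 : Matrix (Fin n) (Fin n) ℂ)‖ + ‖(1 : Matrix (Fin n) (Fin n) ℂ)‖)
  rw [zero_mul] at h3
  refine tendsto_of_tendsto_of_tendsto_of_le_of_le' tendsto_const_nhds h3
    (Eventually.of_forall fun t => norm_nonneg _) ?_
  filter_upwards [eventually_ge_atTop 0] with t ht
  have h4 : Z t - 1 = cay (Z t) * (Z t + 1) := by
    unfold cay
    have := Matrix.nonsing_inv_mul (Z t + 1) (hdet t ht).isUnit
    rw [sub_mul, add_mul, this, one_mul]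
    abel
  rw [h4]
  refine (norm_mul_le _ _).trans ?_
  gcongr
  refine (norm_add_le _ _).trans ?_
  rw [hnZ t ht]

theorem aux_Csmooth {n : ℕ} (A : ℝ → Matrix (Fin n) (Fin n) ℂ)
    (hA : ContDiff ℝ (⊤ : ℕ∞) A) (S0 : Matrix (Fin n) (Fin n) ℂ) (j : ℕ) :
    ContDiff ℝ (⊤ : ℕ∞) (Cmat A S0 j) := by
  induction j with
  | zero => exact contDiff_const
  | succ j ih =>
    have h1 : ContDiff ℝ (⊤ : ℕ∞) (deriv (Cmat A S0 j)) := (contDiff_infty_iff_deriv.1 ih).2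
    exact h1.add ((ih.mul hA).sub (hA.mul ih))

theorem aux_coron {n : ℕ} (A : ℝ → Matrix (Fin n) (Fin n) ℂ)
    (hA : ContDiff ℝ (⊤ : ℕ∞) A) (hAs : ∀ t, (A t)ᴴ = -(A t)) (S0 : Matrix (Fin n) (Fin n) ℂ)
    (P : ℝ → Matrix (Fin n) (Fin n) ℂ) (hP : ∀ t, HasDerivAt P (A t * P t) t)
    (Q : Matrix (Fin n) (Fin n) ℂ) (h0 : ∀ t, (Q * ((P t)ᴴ * S0 * P t)).trace.re = 0) (j : ℕ) :
    ∀ t, (Q * ((P t)ᴴ * Cmat A S0 j t * P t)).trace.re = 0 := by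
  induction j with
  | zero => exact h0
  | succ j ih =>
    intro t
    have hd : HasDerivAt (Cmat A S0 j) (deriv (Cmat A S0 j) t) t :=
      ((aux_Csmooth A hA S0 j).differentiable (by simp) t).hasDerivAt
    have h1 := htr (hmul1 (hasDerivWithinAt_const t Set.univ Q) (hmul1 (hmul1
      (hct (hP t).hasDerivWithinAt) hd.hasDerivWithinAt) (hP t).hasDerivWithinAt))
    have h2 : HasDerivWithinAt (fun t => (Q * ((P t)ᴴ * Cmat A S0 j t * P t)).trace.re) 0
        Set.univ t := by
      rw [funext ih]
      exact hasDerivWithinAt_const _ _ _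
    have h3 := (hasDerivWithinAt_univ.1 h1).unique (hasDerivWithinAt_univ.1 h2)
    rw [← h3, conjTranspose_mul, hAs]
    congr 2
    have h4 : Cmat A S0 (j+1) t = deriv (Cmat A S0 j) t
      + (Cmat A S0 j t * A t - A t * Cmat A S0 j t) := rfl
    rw [h4]
    noncomm_ring

theorem aux_main
    (n m : ℕ) (T : ℝ) (hT : 0 < T)
    (S : Fin m → Matrix (Fin n) (Fin n) ℂ)
    (hS : ∀ k, (S k)ᴴ = -(S k))
    (f : Fin m → ℝ) (hf : ∀ k, 0 < f k)
    (Xgoal : Matrix (Fin n) (Fin n) ℂ)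
    (hXgoal : Xgoal ∈ Matrix.unitaryGroup (Fin n) ℂ)
    (hdet : (1 + Xgoal).det ≠ 0)
    (ubar : Fin m → ℝ → ℝ)
    (hsmooth : ∀ k, ContDiff ℝ (⊤ : ℕ∞) (ubar k))
    (hper : ∀ k t, ubar k (t + T) = ubar k t)
    (hodd : ∀ k t, ubar k (T - t) = -(ubar k t))
    (hCoron : (Submodule.span ℝ
        {B : Matrix (Fin n) (Fin n) ℂ |
          ∃ (k : Fin m) (j : ℕ), Cmat (fun t => ∑ k', ubar k' t • S k') (S k) j 0 = B} :
        Set (Matrix (Fin n) (Fin n) ℂ)) = {B | Bᴴ = -B})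
    (XbarI : ℝ → Matrix (Fin n) (Fin n) ℂ)
    (hXbarI0 : XbarI 0 = 1)
    (hXbarIode : ∀ t, HasDerivAt XbarI (∑ k, ubar k t • (S k * XbarI t)) t)
    (Xbar : ℝ → Matrix (Fin n) (Fin n) ℂ)
    (hXbar : Xbar = fun t => XbarI t * Xgoal)
    (X : ℝ → Matrix (Fin n) (Fin n) ℂ)
    (hX0 : X 0 = 1)
    (hXode : ∀ t ∈ Set.Ici (0 : ℝ), HasDerivWithinAt X
      (∑ k, (ubar k t + utildeFb (f k) (S k) Xbar ((Xbar t)ᴴ * X t) t) • (S k * X t))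
      (Set.Ici (0 : ℝ)) t) :
    Tendsto (fun t => (Xbar t)ᴴ * X t) atTop (𝓝 1) ∧
    Tendsto (fun j : ℕ => X (j * T)) atTop (𝓝 Xgoal) := by
  have hsk : ∀ c : Fin m → ℝ, (∑ k, c k • S k)ᴴ = -(∑ k, c k • S k) := by
    intro c
    simp [conjTranspose_sum, conjTranspose_smul, hS]
  have hlin : ∀ (c : Fin m → ℝ) (M : Matrix (Fin n) (Fin n) ℂ),
      ∑ k, c k • (S k * M) = (∑ k, c k • S k) * M := by
    intro c M
    rw [Finset.sum_mul]
    simp only [smul_mul_assoc]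
  set A : ℝ → Matrix (Fin n) (Fin n) ℂ := fun t => ∑ k', ubar k' t • S k' with hAdef
  have hAs : ∀ t, (A t)ᴴ = -(A t) := fun t => hsk _
  have hAsm : ContDiff ℝ (⊤ : ℕ∞) A :=
    ContDiff.sum fun k _ => (hsmooth k).smul contDiff_const
  have hAper : ∀ t, A (t + T) = A t := fun t => by simp only [hAdef, hper]
  have hAodd : ∀ t, A (T - t) = -(A t) := fun t => by simp [hAdef, hodd]
  have hI : ∀ t, HasDerivAt XbarI (A t * XbarI t) t := fun t => by
    have := hXbarIode t
    rwa [hlin] at this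
  have hIw : ∀ t ∈ Set.univ, HasDerivWithinAt XbarI (A t * XbarI t) Set.univ t :=
    fun t _ => (hI t).hasDerivWithinAt
  have hIu : ∀ t, (XbarI t)ᴴ * XbarI t = 1 := by
    intro t
    rw [hconst convex_univ (fun t _ => hAs t) hIw hIw (Set.mem_univ 0) (Set.mem_univ t), hXbarI0]
    simp
  have hIu2 : ∀ t, XbarI t * (XbarI t)ᴴ = 1 := fun t => mul_eq_one_comm.1 (hIu t)
  have hIT : XbarI T = 1 := by
    have hrev : ∀ t ∈ Set.univ, HasDerivWithinAt (fun t => XbarI (T - t)) (A t * XbarI (T - t))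
        Set.univ t := by
      intro t _
      have h1 := (hI (T - t)).scomp t ((hasDerivAt_id t).const_sub T)
      refine (h1.congr_deriv ?_).hasDerivWithinAt
      rw [hAodd]
      simp
    have h1 := hconst convex_univ (fun t _ => hAs t) hIw hrev (Set.mem_univ (T/2)) (Set.mem_univ 0)
    simp only [sub_zero, hXbarI0, conjTranspose_one, one_mul] at h1
    rw [h1, show T - T/2 = T/2 by ring, hIu]
  have hIper : ∀ t, XbarI (t + T) = XbarI t := by
    have hsh : ∀ t ∈ Set.univ, HasDerivWithinAt (fun t => XbarI (t + T)) (A t * XbarI (t + T))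
        Set.univ t := by
      intro t _
      have h1 := (hI (t + T)).comp_add_const t T
      rw [hAper] at h1
      exact h1.hasDerivWithinAt
    intro t
    have h1 := hconst convex_univ (fun t _ => hAs t) hIw hsh (Set.mem_univ 0) (Set.mem_univ t)
    simp only [zero_add, hXbarI0, hIT, conjTranspose_one, one_mul] at h1
    calc XbarI (t + T) = XbarI t * (XbarI t)ᴴ * XbarI (t + T) := by rw [hIu2, one_mul]
      _ = XbarI t := by rw [mul_assoc, h1, mul_one]
  have hG1 : Xgoalᴴ * Xgoal = 1 := Matrix.mem_unitaryGroup_iff'.1 hXgoal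
  have hG2 : Xgoal * Xgoalᴴ = 1 := Matrix.mem_unitaryGroup_iff.1 hXgoal
  have hbd : ∀ t, HasDerivAt Xbar (A t * Xbar t) t := by
    intro t
    rw [hXbar]
    refine hasDerivWithinAt_univ.1 ?_
    refine HasDerivWithinAt.congr_deriv
      (hmul1 (hI t).hasDerivWithinAt (hasDerivWithinAt_const t Set.univ Xgoal)) ?_
    noncomm_ring
  have hb0 : Xbar 0 = Xgoal := by rw [hXbar]; simp [hXbarI0]
  have hbu : ∀ t, (Xbar t)ᴴ * Xbar t = 1 := by
    intro t
    rw [hXbar]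
    simp only [conjTranspose_mul]
    calc Xgoalᴴ * (XbarI t)ᴴ * (XbarI t * Xgoal) = Xgoalᴴ * ((XbarI t)ᴴ * XbarI t) * Xgoal := by
          noncomm_ring
      _ = 1 := by rw [hIu, mul_one, hG1]
  have hbu2 : ∀ t, Xbar t * (Xbar t)ᴴ = 1 := fun t => mul_eq_one_comm.1 (hbu t)
  have hbper : Function.Periodic Xbar T := fun t => by simp only [hXbar, hIper]
  have hbc : Continuous Xbar := continuous_iff_continuousAt.2 fun t => (hbd t).continuousAt
  -- unitarity of X
  have hXu : ∀ t ∈ Set.Ici (0:ℝ), (X t)ᴴ * X t = 1 := by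
    intro t ht
    have hXw : ∀ t ∈ Set.Ici (0:ℝ), HasDerivWithinAt X
        ((∑ k, (ubar k t + utildeFb (f k) (S k) Xbar ((Xbar t)ᴴ * X t) t) • S k) * X t)
        (Set.Ici 0) t := fun t ht => by
      have := hXode t ht
      rwa [hlin] at this
    rw [hconst (convex_Ici 0) (fun t _ => hsk _) hXw hXw (Set.mem_Ici.2 le_rfl) ht, hX0]
    simp
  have hmain : Tendsto (fun t => (Xbar t)ᴴ * X t) atTop (𝓝 1) := by
    refine core T hT f hf (fun t k => (Xbar t)ᴴ * S k * Xbar t) ?_ ?_ _ ?_ ?_ ?_ ?_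
    · fun_prop
    · intro t
      simp only [hbper t]
    · intro t ht
      simp only [conjTranspose_mul, conjTranspose_conjTranspose]
      calc (X t)ᴴ * Xbar t * ((Xbar t)ᴴ * X t) = (X t)ᴴ * (Xbar t * (Xbar t)ᴴ) * X t := by
            noncomm_ring
        _ = 1 := by rw [hbu2, mul_one, hXu t ht]
    · simp only [hb0, hX0, mul_one]
      have h1 : Xgoalᴴ + 1 = (1 + Xgoal)ᴴ := by simp [add_comm]
      rw [h1, det_conjTranspose]
      exact star_ne_zero.2 hdet
    · intro t ht
      refine HasDerivWithinAt.congr_deriv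
        (hmul1 (hct (hbd t).hasDerivWithinAt) (hXode t ht)) ?_
      simp only [add_smul, Finset.sum_add_distrib]
      rw [hlin (fun k => ubar k t), conjTranspose_mul, hAs]
      have h1 : (Xbar t)ᴴ * -A t * X t + (Xbar t)ᴴ * ((∑ k, ubar k t • S k) * X t +
          ∑ k, utildeFb (f k) (S k) Xbar ((Xbar t)ᴴ * X t) t • (S k * X t)) =
          (Xbar t)ᴴ * ∑ k, utildeFb (f k) (S k) Xbar ((Xbar t)ᴴ * X t) t • (S k * X t) := by
        rw [show (∑ k, ubar k t • S k) = A t from rfl]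
        noncomm_ring
      rw [h1, Finset.mul_sum]
      refine Finset.sum_congr rfl fun k _ => ?_
      rw [mul_smul_comm]
      have h2 : (Xbar t)ᴴ * S k * Xbar t * ((Xbar t)ᴴ * X t) = (Xbar t)ᴴ * (S k * X t) := by
        calc _ = (Xbar t)ᴴ * S k * (Xbar t * (Xbar t)ᴴ) * X t := by noncomm_ring
          _ = _ := by rw [hbu2, mul_one, mul_assoc]
      rw [h2]
      rfl
    · intro y hy hw
      let L : Matrix (Fin n) (Fin n) ℂ →ₗ[ℝ] ℝ :=
        { toFun := fun M => ((1 + y) * y * (1 - y) * (Xgoalᴴ * M * Xgoal)).trace.re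
          map_add' := by intros; simp [mul_add, add_mul]
          map_smul' := by intros; simp }
      have hle : Submodule.span ℝ {B : Matrix (Fin n) (Fin n) ℂ |
          ∃ (k : Fin m) (j : ℕ), Cmat A (S k) j 0 = B} ≤ LinearMap.ker L := by
        rw [Submodule.span_le]
        rintro _ ⟨k, j, rfl⟩
        have h1 := aux_coron A hAsm hAs (S k) Xbar hbd ((1 + y) * y * (1 - y))
          (fun t => hw t k) j 0
        rw [hb0] at h1
        exact h1
      have hmem : Xgoal * y * Xgoalᴴ ∈ Submodule.span ℝ {B : Matrix (Fin n) (Fin n) ℂ |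
          ∃ (k : Fin m) (j : ℕ), Cmat A (S k) j 0 = B} := by
        rw [← SetLike.mem_coe, hCoron]
        simp [conjTranspose_mul, hy, mul_assoc]
      have h2 : ((1 + y) * y * (1 - y) * (Xgoalᴴ * (Xgoal * y * Xgoalᴴ) * Xgoal)).trace.re = 0 :=
        hle hmem
      have h3 : Xgoalᴴ * (Xgoal * y * Xgoalᴴ) * Xgoal = y := by
        calc _ = (Xgoalᴴ * Xgoal) * y * (Xgoalᴴ * Xgoal) := by noncomm_ring
          _ = y := by rw [hG1, one_mul, mul_one]
      rw [h3] at h2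
      exact h2
  refine ⟨hmain, ?_⟩
  have hjT : Tendsto (fun j : ℕ => (j:ℝ) * T) atTop atTop :=
    tendsto_natCast_atTop_atTop.atTop_mul_const hT
  have h1 : Tendsto (fun j : ℕ => Xgoal * ((Xbar (j * T))ᴴ * X (j * T))) atTop (𝓝 (Xgoal * 1)) :=
    (hmain.comp hjT).const_mul Xgoal
  rw [mul_one] at h1
  refine h1.congr fun j => ?_
  have h2 : Xbar (j * T) = Xgoal := by rw [hbper.nat_mul_eq, hb0]
  rw [h2, ← mul_assoc, hG2, one_mul]

end aux

/-- Main deterministic stabilization theorem.  With Coron reference controls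
`ū_k` and reference trajectory `X̄(t) = X̄_I(t) X_goal`, the closed-loop solution `X` with
`X(0) = I` satisfies `X̄(t)ᴴ X(t) → I` as `t → ∞`; in particular `X(jT) → X_goal`. -/
theorem deterministic_T_sampling_stabilization
    (n m : ℕ) (hn : 1 ≤ n) (T : ℝ) (hT : 0 < T)
    (S : Fin m → Matrix (Fin n) (Fin n) ℂ)
    (hS : ∀ k, (S k)ᴴ = -(S k))
    (f : Fin m → ℝ) (hf : ∀ k, 0 < f k)
    (Xgoal : Matrix (Fin n) (Fin n) ℂ)
    (hXgoal : Xgoal ∈ Matrix.unitaryGroup (Fin n) ℂ)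
    (hdet : (1 + Xgoal).det ≠ 0)
    -- the Coron reference controls
    (ubar : Fin m → ℝ → ℝ)
    (hsmooth : ∀ k, ContDiff ℝ (⊤ : ℕ∞) (ubar k))
    (hper : ∀ k t, ubar k (t + T) = ubar k t)
    (hodd : ∀ k t, ubar k (T - t) = -(ubar k t))
    (hCoron : (Submodule.span ℝ
        {B : Matrix (Fin n) (Fin n) ℂ |
          ∃ (k : Fin m) (j : ℕ), Cmat (fun t => ∑ k', ubar k' t • S k') (S k) j 0 = B} :
        Set (Matrix (Fin n) (Fin n) ℂ)) = {B | Bᴴ = -B})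
    -- the reference trajectory through the identity and through the goal
    (XbarI : ℝ → Matrix (Fin n) (Fin n) ℂ)
    (hXbarI0 : XbarI 0 = 1)
    (hXbarIode : ∀ t, HasDerivAt XbarI (∑ k, ubar k t • (S k * XbarI t)) t)
    (Xbar : ℝ → Matrix (Fin n) (Fin n) ℂ)
    (hXbar : Xbar = fun t => XbarI t * Xgoal)
    -- the closed-loop trajectory
    (X : ℝ → Matrix (Fin n) (Fin n) ℂ)
    (hX0 : X 0 = 1)
    (hXode : ∀ t ∈ Set.Ici (0 : ℝ), HasDerivWithinAt X
      (∑ k, (ubar k t + utildeFb (f k) (S k) Xbar ((Xbar t)ᴴ * X t) t) • (S k * X t))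
      (Set.Ici (0 : ℝ)) t) :
    Filter.Tendsto (fun t => (Xbar t)ᴴ * X t) Filter.atTop (nhds 1) ∧
    Filter.Tendsto (fun j : ℕ => X (j * T)) Filter.atTop (nhds Xgoal) := by
  exact aux_main n m T hT S hS f hf Xgoal hXgoal hdet ubar hsmooth hper hodd hCoron XbarI hXbarI0
    hXbarIode Xbar hXbar X hX0 hXode
end

section
/- (Genericity of Coron reference controls.) Let n ≥ 1, T > 0, ω = 2π/T, S₁, …, S_m ∈ u(n). Assume there exists a set of Coron reference controls for which there are integers k₁, …, k_d ∈ {1,…,m} and j₁, …, j_d ∈ ℕ (d = dim u(n)) with u(n) = span_ℝ{C_{k_h}^{j_h}(0) : h = 1,…,d}. Let J = max{j₁,…,j_d} and M = ⌊J/2⌋. For a = (a_{k,ℓ}) ∈ ℝ^{mM} let ū_k(t) = Σ_{ℓ=1}^M a_{k,ℓ} sin(ℓωt), and compute the matrices C_{k_h}^{j_h}(0) from these controls via the recursion C_k^0(t) = S_k, C_k^{j+1}(t) = d/dt C_k^j(t) + [C_k^j(t), Σ_ℓ ū_ℓ(t) S_ℓ]. Let O ⊆ ℝ^{mM} be the set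 of a for which u(n) = span_ℝ{C_{k_h}^{j_h}(0) : h = 1,…,d}. Then O is open and dense in ℝ^{mM} and its complement has Lebesgue measure zero. -/
open Matrix Filter MeasureTheory

attribute [local instance] Matrix.frobeniusNormedAddCommGroup Matrix.frobeniusNormedSpace

lemma null_of_analytic {E : Type*} [NormedAddCommGroup E] [NormedSpace ℝ E]
    [FiniteDimensional ℝ E] [MeasurableSpace E] [BorelSpace E] (μ : Measure E)
    [μ.IsAddHaarMeasure] (f : E → ℝ) (hf : ∀ x, AnalyticAt ℝ f x) (a : E) (ha : f a ≠ 0) :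
    μ {x | f x = 0} = 0 := by
  have hcont : Continuous f := continuous_iff_continuousAt.2 fun x => (hf x).continuousAt
  have hline : ∀ x : E, ∀ᵐ t : ℝ, f (a + t • (x - a)) ≠ 0 := by
    intro x
    have hg : AnalyticOnNhd ℝ (fun t : ℝ => f (a + t • (x - a))) Set.univ := by
      intro t _
      have h1 : AnalyticAt ℝ (fun t : ℝ => a + t • (x - a)) t := by fun_prop
      exact (hf _).comp_of_eq h1 rfl
    have h0 : (fun t : ℝ => f (a + t • (x - a))) 0 ≠ 0 := by simpa using ha
    have h2 := hg.preimage_zero_mem_codiscrete h0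
    have h3 := ae_restrict_le_codiscreteWithin (μ := volume) (U := (Set.univ : Set ℝ)) MeasurableSet.univ h2
    rw [Measure.restrict_univ] at h3
    exact h3
  have hmeas : MeasurableSet {z : E × ℝ | f (a + z.2 • (z.1 - a)) ≠ 0} := by
    apply IsOpen.measurableSet
    exact isOpen_ne_fun (by fun_prop) continuous_const
  have h4 : ∀ᵐ t : ℝ, ∀ᵐ x ∂μ, f (a + t • (x - a)) ≠ 0 :=
    (Measure.ae_ae_comm (μ := μ) (ν := volume) (p := fun x t => f (a + t • (x - a)) ≠ 0) hmeas).1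
      (Eventually.of_forall hline)
  have h5 : ∀ᵐ t : ℝ, t ≠ 0 := by simp [ae_iff]
  obtain ⟨t, h6, h7⟩ := (h4.and h5).exists
  have h8 : μ ((fun x => t • x) ⁻¹' ((fun y => (a - t • a) + y) ⁻¹' {x | f x = 0})) = 0 := by
    rw [ae_iff] at h6
    convert h6 using 2
    ext x
    simp only [Set.mem_preimage, Set.mem_ofPred_eq, not_not]
    rw [show a - t • a + t • x = a + t • (x - a) by rw [smul_sub]; abel]
  rw [Measure.addHaar_preimage_smul μ h7, measure_preimage_add] at h8
  rcases mul_eq_zero.1 h8 with h | h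
  · exfalso
    rw [ENNReal.ofReal_eq_zero] at h
    have : 0 < |(t ^ Module.finrank ℝ E)⁻¹| := by positivity
    linarith
  · exact h

lemma local_det {E V ι : Type*} [NormedAddCommGroup E] [NormedSpace ℝ E]
    [NormedAddCommGroup V] [NormedSpace ℝ V] [FiniteDimensional ℝ V] [Finite ι]
    (U : Submodule ℝ V) (v : E → ι → V) (hv : ∀ i a, AnalyticAt ℝ (fun a => v a i) a)
    (hU : ∀ a i, v a i ∈ U) (a₀ : E) (h₀ : Submodule.span ℝ (Set.range (v a₀)) = U) :
    ∃ f : E → ℝ, (∀ a, AnalyticAt ℝ f a) ∧ f a₀ ≠ 0 ∧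
      ∀ a, f a ≠ 0 → Submodule.span ℝ (Set.range (v a)) = U := by
  classical
  obtain ⟨κ, e, he, hs, hli⟩ := exists_linearIndependent' ℝ (v a₀)
  have : Finite κ := Finite.of_injective e he
  have := Fintype.ofFinite κ
  obtain ⟨L, hL⟩ := LinearMap.exists_leftInverse_of_injective
    (Fintype.linearCombination ℝ (v a₀ ∘ e))
    (by rw [LinearMap.ker_eq_bot]; exact hli.fintypeLinearCombination_injective)
  refine ⟨fun a => (Matrix.of fun i j => L (v a (e j)) i).det, ?_, ?_, ?_⟩
  · intro a
    simp only [Matrix.det_apply, Matrix.of_apply]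
    refine Finset.analyticAt_fun_sum _ fun σ _ => ?_
    have : AnalyticAt ℝ (fun a => ∏ i, L (v a (e i)) (σ i)) a := by
      refine Finset.analyticAt_fun_prod _ fun i _ => ?_
      let ℓ : V →L[ℝ] ℝ := LinearMap.toContinuousLinearMap ((LinearMap.proj (σ i)).comp L)
      exact (ℓ.analyticAt _).comp (hv (e i) a)
    rcases Int.units_eq_one_or (Equiv.Perm.sign σ) with h | h
    · simpa [h] using this
    · simp only [h, Units.neg_smul, one_smul]
      exact this.neg
  · have : (Matrix.of fun i j => L (v a₀ (e j)) i) = (1 : Matrix κ κ ℝ) := by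
      ext i j
      have := congrArg (fun F => F (Pi.single j 1) i) hL
      simp [Fintype.linearCombination_apply_single] at this
      simp [this, Matrix.one_apply, Pi.single_apply]
    simp only [this]; simp
  · intro a ha
    have h1 := Matrix.linearIndependent_cols_of_det_ne_zero ha
    have h2 : LinearIndependent ℝ (v a ∘ e) := by
      apply LinearIndependent.of_comp L
      exact h1
    have hsub : Submodule.span ℝ (Set.range (v a ∘ e)) ≤ U := by
      rw [Submodule.span_le]; rintro _ ⟨i, rfl⟩; exact hU _ _
    have h3 : Submodule.span ℝ (Set.range (v a ∘ e)) = U := by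
      apply Submodule.eq_of_le_of_finrank_eq hsub
      rw [finrank_span_eq_card h2, ← h₀, ← hs, finrank_span_eq_card hli]
    apply le_antisymm
    · rw [Submodule.span_le]; rintro _ ⟨i, rfl⟩; exact hU _ _
    · rw [← h3]; exact Submodule.span_mono (Set.range_comp_subset_range _ _)

lemma generic_span {E V ι : Type*} [NormedAddCommGroup E] [NormedSpace ℝ E]
    [FiniteDimensional ℝ E] [MeasurableSpace E] [BorelSpace E] (μ : Measure E)
    [μ.IsAddHaarMeasure]
    [NormedAddCommGroup V] [NormedSpace ℝ V] [FiniteDimensional ℝ V] [Finite ι]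
    (U : Submodule ℝ V) (v : E → ι → V) (hv : ∀ i a, AnalyticAt ℝ (fun a => v a i) a)
    (hU : ∀ a i, v a i ∈ U) (a₀ : E) (h₀ : Submodule.span ℝ (Set.range (v a₀)) = U) :
    IsOpen {a | Submodule.span ℝ (Set.range (v a)) = U} ∧
    Dense {a | Submodule.span ℝ (Set.range (v a)) = U} ∧
    μ {a | Submodule.span ℝ (Set.range (v a)) = U}ᶜ = 0 := by
  have hnull : μ {a | Submodule.span ℝ (Set.range (v a)) = U}ᶜ = 0 := by
    obtain ⟨f, hf, h1, h2⟩ := local_det U v hv hU a₀ h₀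
    refine measure_mono_null ?_ (null_of_analytic μ f hf a₀ h1)
    intro a ha
    by_contra h
    exact ha (h2 a h)
  refine ⟨?_, ?_, hnull⟩
  · rw [isOpen_iff_mem_nhds]
    intro a ha
    obtain ⟨f, hf, h1, h2⟩ := local_det U v hv hU a ha
    filter_upwards [(hf a).continuousAt.eventually_ne h1] with b hb using h2 b hb
  · exact Measure.dense_of_ae (μ := μ) (ae_iff.2 hnull)

lemma vander_solve {M : ℕ} (c : Fin M → ℝ) (hc : ∀ l, 0 < c l) (hinj : Function.Injective c)
    (y : Fin M → ℝ) : ∃ a : Fin M → ℝ, ∀ p : Fin M,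
      ∑ l, a l * (c l ^ (2 * p.1 + 1) * (-1) ^ p.1) = y p := by
  have hdet : (Matrix.vandermonde fun l => c l ^ 2)ᵀ.det ≠ 0 := by
    rw [Matrix.det_transpose, Matrix.det_vandermonde_ne_zero_iff]
    intro i j h
    exact hinj ((pow_left_inj₀ (hc i).le (hc j).le two_ne_zero).1 h)
  set N := (Matrix.vandermonde fun l => c l ^ 2)ᵀ with hN
  let b := N⁻¹ *ᵥ (fun p => (-1) ^ p.1 * y p)
  have hb : N *ᵥ b = (fun p => (-1) ^ p.1 * y p) := by
    simp only [b, Matrix.mulVec_mulVec]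
    rw [Matrix.mul_nonsing_inv _ (isUnit_iff_ne_zero.2 hdet), Matrix.one_mulVec]
  refine ⟨fun l => b l / c l, fun p => ?_⟩
  have h := congrFun hb p
  simp only [Matrix.mulVec, dotProduct, hN, Matrix.transpose_apply, Matrix.vandermonde_apply] at h
  have h2 : y p = (-1) ^ p.1 * ∑ l, (c l ^ 2) ^ p.1 * b l := by
    rw [h, ← mul_assoc, ← mul_pow]; simp
  rw [h2, Finset.mul_sum]
  refine Finset.sum_congr rfl fun l _ => ?_
  have := (hc l).ne'
  field_simp
  ring

/-- Formal expressions for the matrices `C_k^j` in terms of the jet of `A`. -/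
inductive CExpr : Type
  | base : CExpr
  | zer : CExpr
  | jet : ℕ → CExpr
  | plus : CExpr → CExpr → CExpr
  | brk : CExpr → CExpr → CExpr

namespace CExpr

def ev {R : Type*} [Ring R] (s : R) (x : ℕ → R) : CExpr → R
  | base => s
  | zer => 0
  | jet q => x q
  | plus a b => ev s x a + ev s x b
  | brk a b => ev s x a * ev s x b - ev s x b * ev s x a

def der : CExpr → CExpr
  | base => zer
  | zer => zer
  | jet q => jet (q + 1)
  | plus a b => plus a.der b.der
  | brk a b => plus (brk a.der b) (brk a b.der)

def dep (N : ℕ) : CExpr → Prop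
  | base => True
  | zer => True
  | jet q => q < N
  | plus a b => dep N a ∧ dep N b
  | brk a b => dep N a ∧ dep N b

def cx : ℕ → CExpr
  | 0 => base
  | j + 1 => plus (cx j).der (brk (cx j) (jet 0))

lemma dep_mono {N N' : ℕ} (h : N ≤ N') : ∀ e : CExpr, e.dep N → e.dep N'
  | base, _ => trivial
  | zer, _ => trivial
  | jet _, hq => lt_of_lt_of_le hq h
  | plus a b, hq => ⟨dep_mono h a hq.1, dep_mono h b hq.2⟩
  | brk a b, hq => ⟨dep_mono h a hq.1, dep_mono h b hq.2⟩

lemma dep_der {N : ℕ} : ∀ e : CExpr, e.dep N → e.der.dep (N + 1)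
  | base, _ => trivial
  | zer, _ => trivial
  | jet _, hq => Nat.succ_lt_succ hq
  | plus a b, hq => ⟨dep_der a hq.1, dep_der b hq.2⟩
  | brk a b, hq => ⟨⟨dep_der a hq.1, dep_mono (Nat.le_succ _) b hq.2⟩,
      ⟨dep_mono (Nat.le_succ _) a hq.1, dep_der b hq.2⟩⟩

lemma dep_cx : ∀ j, (cx j).dep j
  | 0 => trivial
  | j + 1 => ⟨dep_der _ (dep_cx j), dep_mono (Nat.le_succ _) _ (dep_cx j), Nat.succ_pos _⟩

lemma ev_congr {R : Type*} [Ring R] (s : R) (x y : ℕ → R) {N : ℕ} (h : ∀ q < N, x q = y q) :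
    ∀ e : CExpr, e.dep N → e.ev s x = e.ev s y
  | base, _ => rfl
  | zer, _ => rfl
  | jet q, hq => h q hq
  | plus a b, hq => by
      simp only [ev, ev_congr s x y h a hq.1, ev_congr s x y h b hq.2]
  | brk a b, hq => by
      simp only [ev, ev_congr s x y h a hq.1, ev_congr s x y h b hq.2]

lemma ev_hasDerivAt {R : Type*} [NormedRing R] [NormedAlgebra ℝ R] (s : R) (x : ℕ → ℝ → R)
    (hx : ∀ q t, HasDerivAt (x q) (x (q + 1) t) t) (t : ℝ) :
    ∀ e : CExpr, HasDerivAt (fun t => e.ev s (fun q => x q t)) (e.der.ev s (fun q => x q t)) t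
  | base => hasDerivAt_const t s
  | zer => hasDerivAt_const t 0
  | jet q => hx q t
  | plus a b => (ev_hasDerivAt s x hx t a).add (ev_hasDerivAt s x hx t b)
  | brk a b => by
      have ha := ev_hasDerivAt s x hx t a
      have hb := ev_hasDerivAt s x hx t b
      have := (ha.mul hb).sub (hb.mul ha)
      have he : (brk a b).der.ev s (fun q => x q t) =
          a.der.ev s (fun q => x q t) * b.ev s (fun q => x q t) +
          a.ev s (fun q => x q t) * b.der.ev s (fun q => x q t) -
          (b.der.ev s (fun q => x q t) * a.ev s (fun q => x q t) +
          b.ev s (fun q => x q t) * a.der.ev s (fun q => x q t)) := by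
        simp only [ev, der]
        abel
      rw [he]
      exact this

lemma ev_analyticAt {E R : Type*} [NormedAddCommGroup E] [NormedSpace ℝ E]
    [NormedRing R] [NormedAlgebra ℝ R] (s : R) (x : ℕ → E → R)
    (hx : ∀ q a, AnalyticAt ℝ (x q) a) (a : E) :
    ∀ e : CExpr, AnalyticAt ℝ (fun a => e.ev s (fun q => x q a)) a
  | base => analyticAt_const
  | zer => analyticAt_const
  | jet q => hx q a
  | plus c d => (ev_analyticAt s x hx a c).add (ev_analyticAt s x hx a d)
  | brk c d => ((ev_analyticAt s x hx a c).mul (ev_analyticAt s x hx a d)).sub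
      ((ev_analyticAt s x hx a d).mul (ev_analyticAt s x hx a c))

lemma ev_skew {n : ℕ} (s : Matrix (Fin n) (Fin n) ℂ) (x : ℕ → Matrix (Fin n) (Fin n) ℂ)
    (hs : sᴴ = -s) (hx : ∀ q, (x q)ᴴ = -(x q)) : ∀ e : CExpr, (e.ev s x)ᴴ = -(e.ev s x)
  | base => hs
  | zer => by simp [ev]
  | jet q => hx q
  | plus a b => by
      simp only [ev, Matrix.conjTranspose_add, ev_skew s x hs hx a, ev_skew s x hs hx b]; abel
  | brk a b => by
      simp only [ev, Matrix.conjTranspose_sub, Matrix.conjTranspose_mul,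
        ev_skew s x hs hx a, ev_skew s x hs hx b]
      simp

end CExpr

section FrobRing

attribute [local instance] Matrix.frobeniusNormedRing Matrix.frobeniusNormedAlgebra

lemma Cmat_eq {n : ℕ} (s : Matrix (Fin n) (Fin n) ℂ) (x : ℕ → ℝ → Matrix (Fin n) (Fin n) ℂ)
    (hx : ∀ q t, HasDerivAt (x q) (x (q + 1) t) t) (j : ℕ) :
    Cmat (x 0) s j = fun t => (CExpr.cx j).ev s (fun q => x q t) := by
  induction j with
  | zero => funext t; simp [Cmat, CExpr.cx, CExpr.ev]
  | succ j ih =>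
    funext t
    rw [Cmat, ih]
    have h := (CExpr.ev_hasDerivAt s x hx t (CExpr.cx j)).deriv
    simp only [CExpr.cx, CExpr.ev]
    congr 1

lemma Cmat_ctrl {n m : ℕ} (S : Fin m → Matrix (Fin n) (Fin n) ℂ)
    (u : Fin m → ℝ → ℝ) (hu : ∀ k, ContDiff ℝ (⊤ : ℕ∞) (u k))
    (s : Matrix (Fin n) (Fin n) ℂ) (j : ℕ) :
    Cmat (fun t => ∑ k, u k t • S k) s j 0 =
      (CExpr.cx j).ev s (fun q => ∑ k, iteratedDeriv q (u k) 0 • S k) := by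
  have h := Cmat_eq s (fun q t => ∑ k, iteratedDeriv q (u k) t • S k) (fun q t => by
    refine HasDerivAt.fun_sum fun k _ => ?_
    have h1 : HasDerivAt (iteratedDeriv q (u k)) (iteratedDeriv (q + 1) (u k) t) t := by
      rw [iteratedDeriv_succ]
      exact (((hu k).differentiable_iteratedDeriv q (by exact_mod_cast WithTop.coe_lt_top q)) t).hasDerivAt
    exact h1.smul_const (S k)) j
  simp only [iteratedDeriv_zero] at h
  rw [h]

lemma odd_even_deriv (u : ℝ → ℝ) (hu : ∀ t, u (-t) = - u t) (q : ℕ) (hq : Even q) :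
    iteratedDeriv q u 0 = 0 := by
  have h := iteratedDeriv_comp_neg q u 0
  have h2 : (fun x => u (-x)) = -u := by funext t; simp [hu]
  rw [h2, iteratedDeriv_neg, hq.neg_one_pow] at h
  simp at h
  linarith

lemma sin_jet {M : ℕ} (a c : Fin M → ℝ) (q : ℕ) :
    iteratedDeriv q (fun t => ∑ l, a l * Real.sin (c l * t)) 0 =
      ∑ l, a l * (c l ^ q * iteratedDeriv q Real.sin 0) := by
  rw [iteratedDeriv_fun_sum (fun l _ => by fun_prop)]
  refine Finset.sum_congr rfl fun l _ => ?_
  rw [iteratedDeriv_const_mul_field, iteratedDeriv_comp_const_mul (Real.contDiff_sin)]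
  simp

lemma ev_ctrl_analyticAt {n m M : ℕ} (S : Fin m → Matrix (Fin n) (Fin n) ℂ)
    (s : Matrix (Fin n) (Fin n) ℂ) (w : Fin M → ℕ → ℝ) (a : Fin m → Fin M → ℝ) (e : CExpr) :
    AnalyticAt ℝ (fun a : Fin m → Fin M → ℝ =>
      e.ev s (fun q => ∑ k, (∑ l, a k l * w l q) • S k)) a := by
  refine CExpr.ev_analyticAt s
    (fun q (a : Fin m → Fin M → ℝ) => ∑ k, (∑ l, a k l * w l q) • S k) (fun q a => ?_) a e
  refine Finset.analyticAt_fun_sum _ fun k _ => ?_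
  have hk : AnalyticAt ℝ (fun a : Fin m → Fin M → ℝ => ∑ l, a k l * w l q) a := by
    refine Finset.analyticAt_fun_sum _ fun l _ => ?_
    refine AnalyticAt.mul ?_ analyticAt_const
    let p : (Fin m → Fin M → ℝ) →L[ℝ] ℝ :=
      (ContinuousLinearMap.proj (R := ℝ) (φ := fun _ : Fin M => ℝ) l).comp
        (ContinuousLinearMap.proj (R := ℝ) (φ := fun _ : Fin m => Fin M → ℝ) k)
    exact p.analyticAt a
  exact hk.smul (analyticAt_const (v := S k))

lemma skew_add {n : ℕ} (x y : Matrix (Fin n) (Fin n) ℂ) (hx : xᴴ = -x) (hy : yᴴ = -y) :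
    (x + y)ᴴ = -(x + y) := by
  rw [Matrix.conjTranspose_add, hx, hy]; abel

lemma skew_smul {n : ℕ} (r : ℝ) (x : Matrix (Fin n) (Fin n) ℂ) (hx : xᴴ = -x) :
    (r • x)ᴴ = -(r • x) := by
  rw [Matrix.conjTranspose_smul, hx]; simp

lemma skew_sum {n m : ℕ} (S : Fin m → Matrix (Fin n) (Fin n) ℂ) (hS : ∀ k, (S k)ᴴ = -(S k))
    (r : Fin m → ℝ) : (∑ k, r k • S k)ᴴ = -(∑ k, r k • S k) := by
  rw [Matrix.conjTranspose_sum, ← Finset.sum_neg_distrib]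
  exact Finset.sum_congr rfl fun k _ => skew_smul _ _ (hS k)

end FrobRing

/-- Genericity of Coron reference controls.  Assume there are Coron reference
controls `û_k` and indices `k_h`, `j_h` (`h = 1,…,d`, `d = dim u(n) = n²`) such that
`u(n) = span{C_{k_h}^{j_h}(0)}`.  With `J = max j_h` and `M = ⌊J/2⌋`, the set `O` of
amplitude vectors `a ∈ ℝ^{mM}` for which the controls `ū_k(t) = Σ_ℓ a_{k,ℓ} sin(ℓωt)`,
`ω = 2π/T`, again satisfy `u(n) = span{C_{k_h}^{j_h}(0)}` is open and dense, and its
complement has Lebesgue measure zero. -/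
theorem genericity_of_coron_controls
    (n m : ℕ) (hn : 1 ≤ n) (T : ℝ) (hT : 0 < T)
    (S : Fin m → Matrix (Fin n) (Fin n) ℂ)
    (hS : ∀ k, (S k)ᴴ = -(S k))
    -- the given Coron reference controls
    (uhat : Fin m → ℝ → ℝ)
    (hsmooth : ∀ k, ContDiff ℝ (⊤ : ℕ∞) (uhat k))
    (hper : ∀ k t, uhat k (t + T) = uhat k t)
    (hodd : ∀ k t, uhat k (T - t) = -(uhat k t))
    (kh : Fin (n ^ 2) → Fin m) (jh : Fin (n ^ 2) → ℕ)
    (hCoron : (Submodule.span ℝ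
        {B : Matrix (Fin n) (Fin n) ℂ | ∃ h : Fin (n ^ 2),
          Cmat (fun t => ∑ k, uhat k t • S k) (S (kh h)) (jh h) 0 = B} :
        Set (Matrix (Fin n) (Fin n) ℂ)) = {B | Bᴴ = -B})
    (J : ℕ) (hJ : J = Finset.univ.sup jh)
    (M : ℕ) (hM : M = J / 2)
    (O : Set (Fin m → Fin M → ℝ))
    (hO : O = {a : Fin m → Fin M → ℝ |
      (Submodule.span ℝ
        {B : Matrix (Fin n) (Fin n) ℂ | ∃ h : Fin (n ^ 2),
          Cmat
            (fun t => ∑ k, (∑ ℓ : Fin M,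
              a k ℓ * Real.sin ((ℓ.1 + 1) * (2 * Real.pi / T) * t)) • S k)
            (S (kh h)) (jh h) 0 = B} :
        Set (Matrix (Fin n) (Fin n) ℂ)) = {B | Bᴴ = -B}}) :
    IsOpen O ∧ Dense O ∧ MeasureTheory.volume Oᶜ = 0 := by
  subst hO
  set c : Fin M → ℝ := fun ℓ => (ℓ.1 + 1) * (2 * Real.pi / T) with hc
  have hcpos : ∀ l, 0 < c l := fun l => by
    have := Real.pi_pos
    simp only [hc]; positivity
  have hcinj : Function.Injective c := by
    intro i j h
    have hw : 2 * Real.pi / T ≠ 0 := by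
      have := Real.pi_pos
      positivity
    have := mul_right_cancel₀ hw h
    have h2 : (i.1 : ℝ) = j.1 := by linarith
    exact Fin.ext (by exact_mod_cast h2)
  -- the submodule of skew-Hermitian matrices
  let U : Submodule ℝ (Matrix (Fin n) (Fin n) ℂ) :=
    { carrier := {B | Bᴴ = -B}
      add_mem' := fun {x y} hx hy => skew_add x y hx hy
      zero_mem' := by simp
      smul_mem' := fun r x hx => skew_smul r x hx }
  have hUc : (U : Set (Matrix (Fin n) (Fin n) ℂ)) = {B | Bᴴ = -B} := rfl
  let xa : (Fin m → Fin M → ℝ) → ℕ → Matrix (Fin n) (Fin n) ℂ := fun a q =>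
    ∑ k, (∑ l, a k l * (c l ^ q * iteratedDeriv q Real.sin 0)) • S k
  let v : (Fin m → Fin M → ℝ) → Fin (n ^ 2) → Matrix (Fin n) (Fin n) ℂ := fun a h =>
    (CExpr.cx (jh h)).ev (S (kh h)) (xa a)
  have hCv : ∀ a h, Cmat (fun t => ∑ k, (∑ ℓ : Fin M,
              a k ℓ * Real.sin ((ℓ.1 + 1) * (2 * Real.pi / T) * t)) • S k)
            (S (kh h)) (jh h) 0 = v a h := by
    intro a h
    have h1 := Cmat_ctrl S (fun k t => ∑ l : Fin M, a k l * Real.sin (c l * t))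
      (fun k => by fun_prop) (S (kh h)) (jh h)
    simp only [sin_jet] at h1
    exact h1
  have hvU : ∀ a h, v a h ∈ U := fun a h =>
    CExpr.ev_skew _ _ (hS _) (fun q => skew_sum S hS _) _
  have hset : ∀ w : Fin (n ^ 2) → Matrix (Fin n) (Fin n) ℂ,
      ((Submodule.span ℝ {B | ∃ h, w h = B} : Submodule ℝ (Matrix (Fin n) (Fin n) ℂ)) :
        Set (Matrix (Fin n) (Fin n) ℂ)) = {B | Bᴴ = -B} ↔
      Submodule.span ℝ (Set.range w) = U := by
    intro w
    rw [← hUc, SetLike.coe_set_eq]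
    rfl
  simp only [hCv, hset]
  have huodd : ∀ k t, uhat k (-t) = - uhat k t := fun k t => by
    rw [← hodd k t, ← hper k (-t)]; congr 1; ring
  have hJle : ∀ h, jh h ≤ J := fun h => by
    rw [hJ]; exact Finset.le_sup (Finset.mem_univ h)
  choose a₀ ha₀ using fun k => vander_solve c hcpos hcinj
    (fun p => iteratedDeriv (2 * p.1 + 1) (uhat k) 0)
  have hjets : ∀ q < J, xa a₀ q = ∑ k, iteratedDeriv q (uhat k) 0 • S k := by
    intro q hq
    refine Finset.sum_congr rfl fun k _ => ?_
    congr 1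
    rcases Nat.even_or_odd q with he | ⟨p, rfl⟩
    · rw [odd_even_deriv _ (huodd k) q he,
        odd_even_deriv _ Real.sin_neg q he]
      simp
    · have hp : p < M := by omega
      rw [← ha₀ k ⟨p, hp⟩]
      refine Finset.sum_congr rfl fun l _ => ?_
      rw [Real.iteratedDeriv_odd_sin]
      simp
  have h₀ : Submodule.span ℝ (Set.range (v a₀)) = U := by
    rw [← hset, ← hCoron]
    have : ∀ h, v a₀ h = Cmat (fun t => ∑ k, uhat k t • S k) (S (kh h)) (jh h) 0 := by
      intro h
      rw [Cmat_ctrl S uhat hsmooth]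
      exact CExpr.ev_congr _ _ _ hjets _ (CExpr.dep_mono (hJle h) _ (CExpr.dep_cx _))
    simp only [this]
  refine generic_span volume U v ?_ hvU a₀ h₀
  intro h a
  exact ev_ctrl_analyticAt S (S (kh h)) (fun l q => c l ^ q * iteratedDeriv q Real.sin 0) a _
end
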